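/- Among closed convex sets inscribed in a convex polygon P in the plane (i.e., touching every side of P), the one of minimal area is the convex hull of a subset of the vertices of P. -/

import Mathlib

open RealInnerProductSpace MeasureTheory

/-- Affine coordinates adapted to a vertex `w` of a planar convex set `P`: the vertex is the origin,
and the set lies in the first quadrant and has the two segments joining the vertex to its
neighbours `left` and `right` as its intersections with the coordinate axes. -/
structure Corner (P : Set (EuclideanSpace ℝ (Fin 2))) (w : EuclideanSpace ℝ (Fin 2)) where
  left : EuclideanSpace ℝ (Fin 2)
  right : EuclideanSpace ℝ (Fin 2)
  fst : EuclideanSpace ℝ (Fin 2) →ᵃ[ℝ] ℝ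
  snd : EuclideanSpace ℝ (Fin 2) →ᵃ[ℝ] ℝ
  left_mem : left ∈ P
  right_mem : right ∈ P
  fst_self : fst w = 0
  snd_self : snd w = 0
  fst_left : fst left = 1
  snd_left : snd left = 0
  fst_right : fst right = 0
  snd_right : snd right = 1
  fst_nonneg : ∀ p ∈ P, 0 ≤ fst p
  snd_nonneg : ∀ p ∈ P, 0 ≤ snd p
  fst_le_one : ∀ p ∈ P, snd p = 0 → fst p ≤ 1
  snd_le_one : ∀ p ∈ P, fst p = 0 → snd p ≤ 1
  eq_add : ∀ p, p = w + fst p • (left - w) + snd p • (right - w)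

namespace Corner

variable {P : Set (EuclideanSpace ℝ (Fin 2))} {w z : EuclideanSpace ℝ (Fin 2)}

lemma affineMap_add_smul_add_smul (f : EuclideanSpace ℝ (Fin 2) →ᵃ[ℝ] ℝ)
    (w x y : EuclideanSpace ℝ (Fin 2)) (a b : ℝ) :
    f (w + a • (x - w) + b • (y - w)) = f w + a * (f x - f w) + b * (f y - f w) := by
  have h1 := f.map_vadd w (a • (x - w) + b • (y - w))
  have h2 := f.linearMap_vsub x w
  have h3 := f.linearMap_vsub y w
  simp only [vsub_eq_sub, vadd_eq_add, map_add, map_smul, smul_eq_mul] at h1 h2 h3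
  rw [h2, h3] at h1
  rw [add_assoc, add_comm w, h1]
  ring

/-- The part of `P` cut off by the line through the two neighbours of the vertex. -/
def cap (C : Corner P w) : Set (EuclideanSpace ℝ (Fin 2)) :=
  {p ∈ P | C.fst p + C.snd p < 1}

lemma continuous_affineMap (f : EuclideanSpace ℝ (Fin 2) →ᵃ[ℝ] ℝ) : Continuous f :=
  f.continuous_of_finiteDimensional

lemma measurableSet_cap (C : Corner P w) (hP : IsClosed P) : MeasurableSet C.cap :=
  hP.measurableSet.inter
    (isOpen_lt ((continuous_affineMap _).add (continuous_affineMap _)) continuous_const).measurableSet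

lemma cap_subset (C : Corner P w) : C.cap ⊆ P := fun _ hp => hp.1

lemma ext (C : Corner P w) {p q : EuclideanSpace ℝ (Fin 2)} (h1 : C.fst p = C.fst q)
    (h2 : C.snd p = C.snd q) : p = q := by
  rw [C.eq_add p, C.eq_add q, h1, h2]

/-- An extreme point other than the vertex is not in the cap. -/
lemma one_le_of_extreme (C : Corner P w) (hP : Convex ℝ P) (hw : w ∈ P)
    {y : EuclideanSpace ℝ (Fin 2)} (hy : y ∈ P.extremePoints ℝ) (hne : y ≠ w) :
    1 ≤ C.fst y + C.snd y := by
  by_contra! hlt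
  have ha := C.fst_nonneg y hy.1
  have hb := C.snd_nonneg y hy.1
  have hpos : 0 < C.fst y + C.snd y := by
    rcases (add_nonneg ha hb).lt_or_eq with h | h
    · exact h
    · exfalso
      refine hne (C.ext ?_ ?_)
      · rw [C.fst_self]; linarith
      · rw [C.snd_self]; linarith
  set s := C.fst y + C.snd y with hs
  have hz : (C.fst y / s) • C.left + (C.snd y / s) • C.right ∈ P :=
    hP C.left_mem C.right_mem (by positivity) (by positivity) (by rw [← add_div, div_self hpos.ne'])
  refine hne (hy.2 hw hz ⟨1 - s, s, by linarith, hpos, by ring, ?_⟩).symm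
  have h1 : s * (C.fst y / s) = C.fst y := by field_simp
  have h2 : s * (C.snd y / s) = C.snd y := by field_simp
  rw [smul_add, smul_smul, smul_smul, h1, h2]
  conv_rhs => rw [C.eq_add y]
  rw [hs]
  module

lemma eq_or_eq_left (C : Corner P w) (hP : Convex ℝ P) (hw : w ∈ P)
    {y : EuclideanSpace ℝ (Fin 2)} (hy : y ∈ P.extremePoints ℝ) (h : C.snd y = 0) :
    y = w ∨ y = C.left := by
  by_cases hne : y = w
  · exact Or.inl hne
  · right
    have h1 := C.one_le_of_extreme hP hw hy hne
    have h2 := C.fst_le_one y hy.1 h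
    exact C.ext (by rw [C.fst_left]; linarith) (by rw [C.snd_left, h])

lemma eq_or_eq_right (C : Corner P w) (hP : Convex ℝ P) (hw : w ∈ P)
    {y : EuclideanSpace ℝ (Fin 2)} (hy : y ∈ P.extremePoints ℝ) (h : C.fst y = 0) :
    y = w ∨ y = C.right := by
  by_cases hne : y = w
  · exact Or.inl hne
  · right
    have h1 := C.one_le_of_extreme hP hw hy hne
    have h2 := C.snd_le_one y hy.1 h
    exact C.ext (by rw [C.fst_right, h]) (by rw [C.snd_right]; linarith)

/-- A side of `P` through the vertex is trivial or lies on one of the coordinate axes. -/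
lemma side_eq (C : Corner P w) {u : EuclideanSpace ℝ (Fin 2)} {c : ℝ} (hu : u ≠ 0)
    (hle : ∀ p ∈ P, ⟪p, u⟫ ≤ c) (hwc : ⟪w, u⟫ = c) :
    {p ∈ P | ⟪p, u⟫ = c} ⊆ {w} ∨ {p ∈ P | ⟪p, u⟫ = c} = {p ∈ P | C.snd p = 0} ∨
      {p ∈ P | ⟪p, u⟫ = c} = {p ∈ P | C.fst p = 0} := by
  set a := ⟪C.left - w, u⟫ with ha
  set b := ⟪C.right - w, u⟫ with hb
  have key : ∀ p, ⟪p, u⟫ = c + C.fst p * a + C.snd p * b := by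
    intro p
    conv_lhs => rw [C.eq_add p]
    rw [inner_add_left, inner_add_left, real_inner_smul_left, real_inner_smul_left, hwc]
  have ha0 : a ≤ 0 := by
    have := hle _ C.left_mem
    rw [ha, inner_sub_left]; linarith
  have hb0 : b ≤ 0 := by
    have := hle _ C.right_mem
    rw [hb, inner_sub_left]; linarith
  have hab : ¬ (a = 0 ∧ b = 0) := by
    rintro ⟨h1, h2⟩
    have := key (w + u)
    rw [inner_add_left, h1, h2, hwc] at this
    have h3 : ⟪u, u⟫ = 0 := by linarith
    exact hu (inner_self_eq_zero.1 h3)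
  have iff : ∀ p, ⟪p, u⟫ = c ↔ C.fst p * a + C.snd p * b = 0 := by
    intro p
    rw [key p]
    constructor <;> intro h <;> linarith
  simp only [iff]
  by_cases h1 : a = 0
  · right; left
    have h2 : b ≠ 0 := fun h => hab ⟨h1, h⟩
    simp [h1, h2]
  by_cases h2 : b = 0
  · right; right
    simp [h1, h2]
  left
  rintro p ⟨hp, hpe⟩
  have hf := C.fst_nonneg p hp
  have hs := C.snd_nonneg p hp
  have h3 := mul_nonpos_of_nonneg_of_nonpos hf ha0
  have h4 := mul_nonpos_of_nonneg_of_nonpos hs hb0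
  have h5 : C.fst p * a = 0 := by linarith
  have h6 : C.snd p * b = 0 := by linarith
  refine C.ext ?_ ?_
  · rw [C.fst_self]; exact (mul_eq_zero.1 h5).resolve_right h1
  · rw [C.snd_self]; exact (mul_eq_zero.1 h6).resolve_right h2

lemma disjoint_cap_cap (C : Corner P w) (D : Corner P z) (h0 : 1 ≤ D.fst w + D.snd w)
    (h1 : 1 ≤ D.fst C.left + D.snd C.left) (h2 : 1 ≤ D.fst C.right + D.snd C.right) :
    Disjoint C.cap D.cap := by
  rw [Set.disjoint_left]
  rintro p ⟨hp, hpC⟩ ⟨-, hpD⟩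
  have ha := C.fst_nonneg p hp
  have hb := C.snd_nonneg p hp
  rw [C.eq_add p, affineMap_add_smul_add_smul, affineMap_add_smul_add_smul] at hpD
  nlinarith [mul_le_mul_of_nonneg_left h1 ha, mul_le_mul_of_nonneg_left h2 hb,
    mul_le_mul_of_nonneg_left h0 (sub_nonneg.2 hpC.le)]

lemma disjoint_convexHull_cap (C : Corner P w) {V : Set (EuclideanSpace ℝ (Fin 2))}
    (hV : ∀ y ∈ V, 1 ≤ C.fst y + C.snd y) : Disjoint (convexHull ℝ V) C.cap := by
  rw [Set.disjoint_left]
  rintro p hp ⟨-, hpC⟩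
  have hconv : Convex ℝ {q | 1 ≤ C.fst q + C.snd q} :=
    (convex_Ici (1 : ℝ)).affine_preimage (C.fst + C.snd)
  have : 1 ≤ C.fst p + C.snd p := convexHull_min hV hconv hp
  linarith

lemma linearIndependent (C : Corner P w) :
    LinearIndependent ℝ ![C.left - w, C.right - w] := by
  rw [LinearIndependent.pair_iff]
  intro s t h
  have h1 := affineMap_add_smul_add_smul C.fst w C.left C.right s t
  have h2 := affineMap_add_smul_add_smul C.snd w C.left C.right s t
  rw [add_assoc, h, add_zero] at h1 h2
  rw [C.fst_self, C.fst_left, C.fst_right] at h1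
  rw [C.snd_self, C.snd_left, C.snd_right] at h2
  constructor <;> linarith

/-- The triangle with vertices the vertex of `P` and two points on the adjacent sides has its area
proportional to the product of the two lengths. -/
lemma volume_triangle_le (C : Corner P w) (hP : Convex ℝ P) (hw : w ∈ P) {s r : ℝ}
    (hs : 0 < s) (hr : 0 < r) :
    volume {p | 0 ≤ C.fst p ∧ 0 ≤ C.snd p ∧ C.fst p / s + C.snd p / r < 1} ≤
      ENNReal.ofReal (s * r) * volume C.cap := by
  let b := basisOfLinearIndependentOfCardEqFinrank C.linearIndependent (by simp)
  have hb0 : b 0 = C.left - w := by simp [b]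
  have hb1 : b 1 = C.right - w := by simp [b]
  let M := Matrix.toLin b b (Matrix.diagonal ![s, r])
  have hM0 : M (C.left - w) = s • (C.left - w) := by
    rw [← hb0, Matrix.toLin_self]; simp
  have hM1 : M (C.right - w) = r • (C.right - w) := by
    rw [← hb1, Matrix.toLin_self]; simp
  have hdet : LinearMap.det M = s * r := by
    simp [M, LinearMap.det_toLin]
  have hsub : {p | 0 ≤ C.fst p ∧ 0 ≤ C.snd p ∧ C.fst p / s + C.snd p / r < 1} ⊆
      (fun x => (w - M w) + x) '' (M '' C.cap) := by
    rintro p ⟨h1, h2, h3⟩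
    set q := w + (C.fst p / s) • (C.left - w) + (C.snd p / r) • (C.right - w) with hq
    have hqP : q ∈ P := by
      have h4 : 0 ≤ C.fst p / s := by positivity
      have h5 : 0 ≤ C.snd p / r := by positivity
      have := hP.sum_mem (t := Finset.univ)
        (w := ![1 - C.fst p / s - C.snd p / r, C.fst p / s, C.snd p / r])
        (z := ![w, C.left, C.right])
        (by intro i _; fin_cases i <;> simp <;> linarith)
        (by simp [Fin.sum_univ_three]; ring)
        (by intro i _; fin_cases i <;> simp [hw, C.left_mem, C.right_mem])
      convert this using 1
      simp only [Fin.sum_univ_three, hq]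
      simp
      module
    refine ⟨M q, ⟨q, ⟨hqP, ?_⟩, rfl⟩, ?_⟩
    · rw [hq, affineMap_add_smul_add_smul, affineMap_add_smul_add_smul]
      simp only [C.fst_self, C.snd_self, C.fst_left, C.snd_left, C.fst_right, C.snd_right]
      linarith
    · simp only [hq, map_add, map_smul, hM0, hM1, smul_smul]
      rw [div_mul_cancel₀ _ hs.ne', div_mul_cancel₀ _ hr.ne']
      conv_rhs => rw [C.eq_add p]
      abel
  refine (measure_mono hsub).trans ?_
  rw [Set.image_add_left, measure_preimage_add, Measure.addHaar_image_linearMap, hdet,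
    abs_of_pos (mul_pos hs hr)]

/-- A point outside of a set `K` that touches the two sides adjacent to a vertex lies in the
triangle cut off there, provided that a half-plane containing `K` contains neither the point nor
the vertex. -/
lemma div_add_div_lt_one (C : Corner P w) (l : EuclideanSpace ℝ (Fin 2) →ₗ[ℝ] ℝ) {d : ℝ}
    {p x y : EuclideanSpace ℝ (Fin 2)} (hp : p ∈ P) (hx : C.snd x = 0) (hy : C.fst y = 0)
    (hx0 : 0 < C.fst x) (hy0 : 0 < C.snd y) (hlx : l x < d) (hly : l y < d) (hlp : d < l p)
    (hlw : d < l w) : C.fst p / C.fst x + C.snd p / C.snd y < 1 := by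
  have hX : l x = l w + C.fst x * (l C.left - l w) := by
    have := affineMap_add_smul_add_smul l.toAffineMap w C.left C.right (C.fst x) (C.snd x)
    rw [← C.eq_add x] at this
    simpa [hx] using this
  have hY : l y = l w + C.snd y * (l C.right - l w) := by
    have := affineMap_add_smul_add_smul l.toAffineMap w C.left C.right (C.fst y) (C.snd y)
    rw [← C.eq_add y] at this
    simpa [hy] using this
  have hp' : l p = l w + C.fst p * (l C.left - l w) + C.snd p * (l C.right - l w) := by
    have := affineMap_add_smul_add_smul l.toAffineMap w C.left C.right (C.fst p) (C.snd p)
    rw [← C.eq_add p] at this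
    simpa using this
  set a := C.fst p / C.fst x with ha
  set b := C.snd p / C.snd y with hb
  have ha' : C.fst p = a * C.fst x := by rw [ha]; field_simp
  have hb' : C.snd p = b * C.snd y := by rw [hb]; field_simp
  have ha0 : 0 ≤ a := div_nonneg (C.fst_nonneg p hp) hx0.le
  have hb0 : 0 ≤ b := div_nonneg (C.snd_nonneg p hp) hy0.le
  have hp2 : l p = l w + a * (l x - l w) + b * (l y - l w) := by
    rw [hp', ha', hb', hX, hY]; ring
  by_contra! h
  nlinarith [mul_nonneg ha0 (sub_nonneg.2 hlx.le), mul_nonneg hb0 (sub_nonneg.2 hly.le),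
    mul_nonneg (sub_nonneg.2 h) (sub_nonneg.2 hlw.le)]

end Corner

/-- A function that is convex in each variable separately does not decrease when each of its
arguments, in turn, is moved to a suitable extreme position. -/
lemma exists_le_of_forall_mem_convexHull {ι E : Type*} [DecidableEq ι] [AddCommGroup E] [Module ℝ E]
    (G : (ι → E) → ℝ) (hG : ∀ x i, ConvexOn ℝ Set.univ fun y => G (Function.update x i y))
    (A : ι → Set E) (S : Finset ι) (x : ι → E) (hx : ∀ i ∈ S, x i ∈ convexHull ℝ (A i)) :
    ∃ y : ι → E, (∀ i ∈ S, y i ∈ A i) ∧ (∀ i ∉ S, y i = x i) ∧ G x ≤ G y := by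
  induction S using Finset.induction_on with
  | empty => exact ⟨x, by simp, by simp, le_rfl⟩
  | insert i S hi ih =>
    obtain ⟨y, hyA, hyx, hle⟩ := ih fun j hj => hx j (Finset.mem_insert_of_mem hj)
    have hmem : y i ∈ convexHull ℝ (A i) := by
      rw [hyx i hi]; exact hx i (Finset.mem_insert_self i S)
    obtain ⟨z, hz, hle'⟩ := (hG y i).exists_ge_of_mem_convexHull (Set.subset_univ _) hmem
    rw [Function.update_eq_self] at hle'
    refine ⟨Function.update y i z, fun j hj => ?_, fun j hj => ?_, hle.trans hle'⟩
    · by_cases hji : j = i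
      · subst hji; simpa using hz
      · rw [Function.update_of_ne hji]
        exact hyA j ((Finset.mem_insert.1 hj).resolve_left hji)
    · rw [Finset.mem_insert, not_or] at hj
      rw [Function.update_of_ne hj.1]
      exact hyx j hj.2

section Polygon

variable {m : ℕ} {v : Fin m → EuclideanSpace ℝ (Fin 2)} {c : Fin m → ℝ}
  {P : Set (EuclideanSpace ℝ (Fin 2))} {w : EuclideanSpace ℝ (Fin 2)}

lemma exists_pos_add_smul_mem (hP : P = {x | ∀ i : Fin m, ⟪x, v i⟫ ≤ c i}) (hw : w ∈ P)
    {d : EuclideanSpace ℝ (Fin 2)} (hd : ∀ i, ⟪w, v i⟫ = c i → ⟪d, v i⟫ ≤ 0) :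
    ∃ ε : ℝ, 0 < ε ∧ w + ε • d ∈ P := by
  have hev : ∀ᶠ ε : ℝ in nhdsWithin 0 (Set.Ioi 0), ∀ i, ⟪w + ε • d, v i⟫ ≤ c i := by
    rw [Filter.eventually_all]
    intro i
    have hwi : ⟪w, v i⟫ ≤ c i := by rw [hP] at hw; exact hw i
    rcases hwi.lt_or_eq with h | h
    · have hcont : Continuous fun ε : ℝ => ⟪w + ε • d, v i⟫ := by fun_prop
      have h0 : ⟪w + (0 : ℝ) • d, v i⟫ < c i := by simpa using h
      filter_upwards [nhdsWithin_le_nhds (hcont.continuousAt.eventually_lt_const h0)] with ε hε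
      exact hε.le
    · filter_upwards [self_mem_nhdsWithin] with ε hε
      rw [inner_add_left, real_inner_smul_left, h]
      have := mul_nonpos_of_nonneg_of_nonpos (le_of_lt (Set.mem_Ioi.1 hε)) (hd i h)
      linarith
  obtain ⟨ε, h1, h2⟩ := (hev.and self_mem_nhdsWithin).exists
  exact ⟨ε, h2, by rw [hP]; exact h1⟩

lemma inner_lt_of_mem_interior (hv : ∀ i, v i ≠ 0) (hP : P = {x | ∀ i : Fin m, ⟪x, v i⟫ ≤ c i})
    {z : EuclideanSpace ℝ (Fin 2)} (hz : z ∈ interior P) (i : Fin m) : ⟪z, v i⟫ < c i := by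
  have hcont : Continuous fun ε : ℝ => z + ε • v i := by fun_prop
  have hev : ∀ᶠ ε : ℝ in nhdsWithin 0 (Set.Ioi 0), z + ε • v i ∈ P :=
    nhdsWithin_le_nhds (hcont.continuousAt.eventually_mem
      (by simpa using mem_interior_iff_mem_nhds.1 hz))
  obtain ⟨ε, h1, h2⟩ := (hev.and self_mem_nhdsWithin).exists
  rw [hP] at h1
  have h3 := h1 i
  rw [inner_add_left, real_inner_smul_left] at h3
  have h4 := mul_pos (Set.mem_Ioi.1 h2) (real_inner_self_pos.2 (hv i))
  linarith

lemma eq_zero_of_forall_active (hP : P = {x | ∀ i : Fin m, ⟪x, v i⟫ ≤ c i})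
    (hw : w ∈ P.extremePoints ℝ) {d : EuclideanSpace ℝ (Fin 2)}
    (hd : ∀ i, ⟪w, v i⟫ = c i → ⟪d, v i⟫ = 0) : d = 0 := by
  obtain ⟨ε, hε, h1⟩ := exists_pos_add_smul_mem hP hw.1 fun i hi => (hd i hi).le
  obtain ⟨δ, hδ, h2⟩ := exists_pos_add_smul_mem (d := -d) hP hw.1 fun i hi => by
    rw [inner_neg_left, hd i hi, neg_zero]
  have h := hw.2 h1 h2 ⟨δ / (ε + δ), ε / (ε + δ), by positivity, by positivity, by field_simp; ring,
    ?_⟩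
  · have : ε • d = 0 := by simpa using h
    exact (smul_eq_zero.1 this).resolve_left hε.ne'
  · have h3 : δ / (ε + δ) + ε / (ε + δ) = 1 := by field_simp; ring
    calc _ = (δ / (ε + δ) + ε / (ε + δ)) • w
          + (δ / (ε + δ) * ε - ε / (ε + δ) * δ) • d := by module
      _ = w := by rw [h3]; have : δ / (ε + δ) * ε - ε / (ε + δ) * δ = 0 := by ring
                  rw [this]; simp

lemma exists_eq_smul_add_smul {d : EuclideanSpace ℝ (Fin 2)} (hd : d ≠ 0) :
    ∃ e : EuclideanSpace ℝ (Fin 2), (∀ a : ℝ, e ≠ a • d) ∧ ∀ q, ∃ a b : ℝ, q = a • d + b • e := by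
  have hn : d 0 ^ 2 + d 1 ^ 2 ≠ 0 := by
    intro h
    refine hd ?_
    ext i
    fin_cases i <;> simp <;> nlinarith [sq_nonneg (d 0), sq_nonneg (d 1)]
  refine ⟨!₂[-d 1, d 0], ?_, fun q => ⟨(q 0 * d 0 + q 1 * d 1) / (d 0 ^ 2 + d 1 ^ 2),
    (q 1 * d 0 - q 0 * d 1) / (d 0 ^ 2 + d 1 ^ 2), ?_⟩⟩
  · intro a h
    have h0 := congrArg (fun x : EuclideanSpace ℝ (Fin 2) => x 0) h
    have h1 := congrArg (fun x : EuclideanSpace ℝ (Fin 2) => x 1) h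
    simp at h0 h1
    exact hn (by linear_combination d 0 * h1 - d 1 * h0)
  · ext i
    fin_cases i <;> simp <;> field_simp <;> ring

/-- At a vertex of a planar polygon, two of the constraints determine the tangent cone. -/
lemma exists_active_pair (hv : ∀ i, v i ≠ 0) (hP : P = {x | ∀ i : Fin m, ⟪x, v i⟫ ≤ c i})
    (hint : (interior P).Nonempty) (hw : w ∈ P.extremePoints ℝ) :
    ∃ i j, ⟪w, v i⟫ = c i ∧ ⟪w, v j⟫ = c j ∧
      (∀ q : EuclideanSpace ℝ (Fin 2), ⟪q, v i⟫ = 0 → ⟪q, v j⟫ = 0 → q = 0) ∧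
      (∃ d : EuclideanSpace ℝ (Fin 2), ⟪d, v i⟫ = 0 ∧ ⟪d, v j⟫ < 0 ∧
        ∀ k, ⟪w, v k⟫ = c k → ⟪d, v k⟫ ≤ 0) ∧
      (∃ d : EuclideanSpace ℝ (Fin 2), ⟪d, v j⟫ = 0 ∧ ⟪d, v i⟫ < 0 ∧
        ∀ k, ⟪w, v k⟫ = c k → ⟪d, v k⟫ ≤ 0) := by
  classical
  obtain ⟨z, hz⟩ := hint
  have hneg : ∀ k, ⟪w, v k⟫ = c k → ⟪z - w, v k⟫ < 0 := by
    intro k hk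
    rw [inner_sub_left, hk]
    linarith [inner_lt_of_mem_interior hv hP hz k]
  let S : Finset (Fin m) := Finset.univ.filter fun k => ⟪w, v k⟫ = c k
  have hS : ∀ k, k ∈ S ↔ ⟪w, v k⟫ = c k := by simp [S]
  have hSne : S.Nonempty := by
    by_contra h
    rw [Finset.not_nonempty_iff_eq_empty] at h
    have h1 := eq_zero_of_forall_active (d := !₂[1, 0]) hP hw fun i hi => by
      have := (hS i).2 hi
      simp [h] at this
    have := congrArg (fun x : EuclideanSpace ℝ (Fin 2) => x 0) h1
    simp at this
  have hd : z - w ≠ 0 := by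
    obtain ⟨k, hk⟩ := hSne
    intro h
    have := hneg k ((hS k).1 hk)
    simp [h] at this
  obtain ⟨e, he, hspan⟩ := exists_eq_smul_add_smul hd
  set d := z - w with hd_def
  let ρ : Fin m → ℝ := fun k => ⟪e, v k⟫ / -⟪d, v k⟫
  have hin : ∀ k ∈ S, ∀ a b : ℝ, ⟪a • d + b • e, v k⟫ = -⟪d, v k⟫ * (b * ρ k - a) := by
    intro k hk a b
    have := (hneg k ((hS k).1 hk)).ne
    rw [inner_add_left, real_inner_smul_left, real_inner_smul_left]
    simp only [ρ]
    field_simp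
    ring
  obtain ⟨i, hi, hmax⟩ := S.exists_max_image ρ hSne
  obtain ⟨j, hj, hmin⟩ := S.exists_min_image ρ hSne
  have hlt : ρ j < ρ i := by
    refine lt_of_le_of_ne (hmin i hi) fun heq => ?_
    have h0 : ρ i • d + (1 : ℝ) • e = 0 := eq_zero_of_forall_active hP hw fun k hk => by
      have hk' := (hS k).2 hk
      rw [hin k hk', le_antisymm (hmax k hk') (heq ▸ hmin k hk')]
      ring
    refine he (-ρ i) ?_
    rw [one_smul] at h0
    rw [neg_smul]
    exact eq_neg_of_add_eq_zero_right h0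
  have hdi := hneg i ((hS i).1 hi)
  have hdj := hneg j ((hS j).1 hj)
  refine ⟨i, j, (hS i).1 hi, (hS j).1 hj, ?_, ⟨ρ i • d + (1 : ℝ) • e, ?_, ?_, ?_⟩,
    ⟨(-ρ j) • d + (-1 : ℝ) • e, ?_, ?_, ?_⟩⟩
  · intro q h1 h2
    obtain ⟨a, b, rfl⟩ := hspan q
    rw [hin i hi] at h1
    rw [hin j hj] at h2
    have h3 := (mul_eq_zero.1 h1).resolve_left (by linarith)
    have h4 := (mul_eq_zero.1 h2).resolve_left (by linarith)
    have h5 : b * (ρ i - ρ j) = 0 := by linarith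
    have h6 : b = 0 := (mul_eq_zero.1 h5).resolve_right (by linarith)
    have h7 : a = 0 := by rw [h6] at h3; linarith
    simp [h6, h7]
  · rw [hin i hi]; ring
  · rw [hin j hj]; nlinarith
  · intro k hk
    rw [hin k ((hS k).2 hk)]
    have := hmax k ((hS k).2 hk)
    nlinarith [hneg k hk]
  · rw [hin j hj]; ring
  · rw [hin i hi]; nlinarith
  · intro k hk
    rw [hin k ((hS k).2 hk)]
    have := hmin k ((hS k).2 hk)
    nlinarith [hneg k hk]

/-- The neighbour of a vertex along a side. -/
lemma exists_neighbour (hP : P = {x | ∀ i : Fin m, ⟪x, v i⟫ ≤ c i}) (hcomp : IsCompact P)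
    (hw : w ∈ P) {i j : Fin m} (hi : ⟪w, v i⟫ = c i) (hj : ⟪w, v j⟫ = c j)
    (hd : ∃ d : EuclideanSpace ℝ (Fin 2), ⟪d, v i⟫ = 0 ∧ ⟪d, v j⟫ < 0 ∧
        ∀ k, ⟪w, v k⟫ = c k → ⟪d, v k⟫ ≤ 0) :
    ∃ x ∈ P, ⟪x, v i⟫ = c i ∧ ⟪x, v j⟫ < c j ∧
      ∀ p ∈ P, ⟪p, v i⟫ = c i → ⟪x, v j⟫ ≤ ⟪p, v j⟫ := by
  obtain ⟨d, hdi, hdj, hdk⟩ := hd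
  obtain ⟨ε, hε, hmem⟩ := exists_pos_add_smul_mem hP hw hdk
  have hclosed : IsClosed {p : EuclideanSpace ℝ (Fin 2) | ⟪p, v i⟫ = c i} :=
    isClosed_eq (by fun_prop) continuous_const
  obtain ⟨x, hx, hmin⟩ := (hcomp.inter_right hclosed).exists_isMinOn ⟨w, hw, hi⟩
    (f := fun p => ⟪p, v j⟫) (by fun_prop)
  refine ⟨x, hx.1, hx.2, ?_, fun p hp hpi => hmin ⟨hp, hpi⟩⟩
  have h1 := hmin (a := w + ε • d) ⟨hmem, by
    simp [inner_add_left, real_inner_smul_left, hdi, hi]⟩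
  simp only [Set.mem_ofPred_eq, inner_add_left, real_inner_smul_left, hj] at h1
  nlinarith [mul_neg_of_pos_of_neg hε hdj]

/-- The affine function vanishing on the line `⟪p, u⟫ = a` and equal to `1` on `⟪p, u⟫ = b`. -/
noncomputable def normalizedSlack (u : EuclideanSpace ℝ (Fin 2)) (a b : ℝ) :
    EuclideanSpace ℝ (Fin 2) →ᵃ[ℝ] ℝ :=
  (a - b)⁻¹ • (AffineMap.const ℝ _ a - (innerₗ (EuclideanSpace ℝ (Fin 2)) u).toAffineMap)

lemma normalizedSlack_apply (u p : EuclideanSpace ℝ (Fin 2)) (a b : ℝ) :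
    normalizedSlack u a b p = (a - ⟪p, u⟫) / (a - b) := by
  simp [normalizedSlack, real_inner_comm, div_eq_inv_mul]

/-- Each vertex of a planar polygon is a corner whose coordinate axes are sides. -/
lemma exists_corner (hv : ∀ i, v i ≠ 0) (hP : P = {x | ∀ i : Fin m, ⟪x, v i⟫ ≤ c i})
    (hcomp : IsCompact P) (hint : (interior P).Nonempty) (hw : w ∈ P.extremePoints ℝ) :
    ∃ (C : Corner P w) (i j : Fin m), {p ∈ P | ⟪p, v i⟫ = c i} = {p ∈ P | C.snd p = 0} ∧
      {p ∈ P | ⟪p, v j⟫ = c j} = {p ∈ P | C.fst p = 0} := by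
  obtain ⟨i, j, hi, hj, hind, hd1, hd2⟩ := exists_active_pair hv hP hint hw
  obtain ⟨x, hxP, hxi, hxj, hxmin⟩ := exists_neighbour hP hcomp hw.1 hi hj hd1
  obtain ⟨y, hyP, hyj, hyi, hymin⟩ := exists_neighbour hP hcomp hw.1 hj hi hd2
  have hle : ∀ p ∈ P, ∀ k, ⟪p, v k⟫ ≤ c k := fun p hp => by rw [hP] at hp; exact hp
  have hx0 : 0 < c j - ⟪x, v j⟫ := by linarith
  have hy0 : 0 < c i - ⟪y, v i⟫ := by linarith
  have zero_i : ∀ p, (c i - ⟪p, v i⟫) / (c i - ⟪y, v i⟫) = 0 ↔ ⟪p, v i⟫ = c i := by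
    intro p
    rw [div_eq_zero_iff, or_iff_left hy0.ne', sub_eq_zero, eq_comm]
  have zero_j : ∀ p, (c j - ⟪p, v j⟫) / (c j - ⟪x, v j⟫) = 0 ↔ ⟪p, v j⟫ = c j := by
    intro p
    rw [div_eq_zero_iff, or_iff_left hx0.ne', sub_eq_zero, eq_comm]
  refine ⟨{ left := x, right := y, fst := normalizedSlack (v j) (c j) ⟪x, v j⟫
            snd := normalizedSlack (v i) (c i) ⟪y, v i⟫
            left_mem := hxP, right_mem := hyP
            fst_self := ?_, snd_self := ?_, fst_left := ?_, snd_left := ?_, fst_right := ?_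
            snd_right := ?_, fst_nonneg := ?_, snd_nonneg := ?_, fst_le_one := ?_
            snd_le_one := ?_, eq_add := ?_ }, i, j, ?_, ?_⟩
  all_goals simp only [normalizedSlack_apply, zero_i, zero_j]
  · exact hj
  · exact hi
  · exact div_self hx0.ne'
  · exact hxi
  · exact hyj
  · exact div_self hy0.ne'
  · exact fun p hp => div_nonneg (by linarith [hle p hp j]) hx0.le
  · exact fun p hp => div_nonneg (by linarith [hle p hp i]) hy0.le
  · intro p hp hpi
    rw [div_le_one hx0]
    linarith [hxmin p hp hpi]
  · intro p hp hpj
    rw [div_le_one hy0]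
    linarith [hymin p hp hpj]
  · intro p
    rw [← sub_eq_zero]
    apply hind
    · simp only [inner_sub_left, inner_add_left, real_inner_smul_left, hi, hxi]
      field_simp
      ring
    · simp only [inner_sub_left, inner_add_left, real_inner_smul_left, hj, hyj]
      field_simp
      ring

/-- A polygon has finitely many vertices. -/
lemma finite_extremePoints (hv : ∀ i, v i ≠ 0) (hP : P = {x | ∀ i : Fin m, ⟪x, v i⟫ ≤ c i})
    (hcomp : IsCompact P) (hint : (interior P).Nonempty) : (P.extremePoints ℝ).Finite := by
  choose C i j hi hj using fun w : P.extremePoints ℝ => exists_corner hv hP hcomp hint w.2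
  refine Set.finite_coe_iff.1 (Finite.of_injective (fun w => (i w, j w)) ?_)
  intro w z hwz
  obtain ⟨h1, h2⟩ := Prod.mk.inj hwz
  have hw1 : (w : EuclideanSpace ℝ (Fin 2)) ∈ {p ∈ P | (C z).snd p = 0} := by
    rw [← hi z, ← h1, hi w]; exact ⟨w.2.1, (C w).snd_self⟩
  have hw2 : (w : EuclideanSpace ℝ (Fin 2)) ∈ {p ∈ P | (C z).fst p = 0} := by
    rw [← hj z, ← h2, hj w]; exact ⟨w.2.1, (C w).fst_self⟩
  exact Subtype.ext ((C z).ext (hw2.2.trans (C z).fst_self.symm) (hw1.2.trans (C z).snd_self.symm))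

lemma convex_polygon (hP : P = {x | ∀ i : Fin m, ⟪x, v i⟫ ≤ c i}) : Convex ℝ P := by
  have h : P = ⋂ i, {x | innerₗ (EuclideanSpace ℝ (Fin 2)) (v i) x ≤ c i} := by
    ext x; simp [hP, real_inner_comm]
  rw [h]
  exact convex_iInter fun i => convex_halfSpace_le (LinearMap.isLinear _) _

/-- A side is the convex hull of the vertices that it contains. -/
lemma side_subset_convexHull (hP : P = {x | ∀ i : Fin m, ⟪x, v i⟫ ≤ c i}) (hcomp : IsCompact P)
    (hfin : (P.extremePoints ℝ).Finite) (k : Fin m) :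
    {p ∈ P | ⟪p, v k⟫ = c k} ⊆
      convexHull ℝ (P.extremePoints ℝ ∩ {p ∈ P | ⟪p, v k⟫ = c k}) := by
  set F := {p ∈ P | ⟪p, v k⟫ = c k} with hF
  have hle : ∀ p ∈ P, ⟪p, v k⟫ ≤ c k := fun p hp => by rw [hP] at hp; exact hp k
  have hFcomp : IsCompact F := hcomp.inter_right (isClosed_eq (by fun_prop) continuous_const)
  have hFconv : Convex ℝ F := by
    have h : F = P ∩ {p | innerₗ (EuclideanSpace ℝ (Fin 2)) (v k) p = c k} := by
      ext x; simp [hF, real_inner_comm]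
    rw [h]
    exact (convex_polygon hP).inter (convex_hyperplane (LinearMap.isLinear _) _)
  have hext : IsExtreme ℝ P F := by
    refine ⟨fun p hp => hp.1, ?_⟩
    rintro x hx y hy z ⟨-, hz⟩ ⟨a, b, ha, hb, hab, rfl⟩
    refine ⟨hx, le_antisymm (hle x hx) ?_⟩
    rw [inner_add_left, real_inner_smul_left, real_inner_smul_left] at hz
    have h1 := mul_le_mul_of_nonneg_left (hle y hy) hb.le
    have h2 : c k = a * c k + b * c k := by rw [← add_mul, hab, one_mul]
    exact le_of_mul_le_mul_left (by linarith) ha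
  have hsub : F.extremePoints ℝ ⊆ P.extremePoints ℝ ∩ F := fun p hp =>
    ⟨hext.extremePoints_subset_extremePoints hp, hp.1⟩
  have hcl := closure_convexHull_extremePoints hFcomp hFconv
  rw [((hfin.subset (hsub.trans Set.inter_subset_left)).isClosed_convexHull (𝕜 := ℝ)).closure_eq]
    at hcl
  calc F = convexHull ℝ (F.extremePoints ℝ) := hcl.symm
    _ ⊆ _ := convexHull_mono hsub

lemma exists_extremePoint_of_notMem (hcomp : IsCompact P) (hconv : Convex ℝ P)
    {l : StrongDual ℝ (EuclideanSpace ℝ (Fin 2))} {d : ℝ} {p : EuclideanSpace ℝ (Fin 2)}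
    (hp : p ∈ P) (hd : d < l p) : ∃ w ∈ P.extremePoints ℝ, d < l w := by
  by_contra! h
  have h1 : closure (convexHull ℝ (P.extremePoints ℝ)) ⊆ {q | l q ≤ d} :=
    closure_minimal (convexHull_min h (convex_halfSpace_le l.isLinear d))
      (isClosed_le l.continuous continuous_const)
  rw [closure_convexHull_extremePoints hcomp hconv] at h1
  exact absurd (h1 hp) (not_le.2 hd)

/-- A convex set inscribed in a polygon can be replaced by the convex hull of some vertices without
increasing the area. -/
lemma exists_vertices_volume_le (hv : ∀ i, v i ≠ 0)
    (hP : P = {x | ∀ i : Fin m, ⟪x, v i⟫ ≤ c i}) (hcomp : IsCompact P)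
    (hint : (interior P).Nonempty) {K : Set (EuclideanSpace ℝ (Fin 2))} (hKc : IsClosed K)
    (hKconv : Convex ℝ K) (hKP : K ⊆ P) (hK : ∀ i : Fin m, ∃ x ∈ K, ⟪x, v i⟫ = c i) :
    ∃ V : Set (EuclideanSpace ℝ (Fin 2)), V ⊆ P.extremePoints ℝ ∧
      (∀ i : Fin m, ∃ x ∈ V, ⟪x, v i⟫ = c i) ∧ volume (convexHull ℝ V) ≤ volume K := by
  classical
  have hle : ∀ p ∈ P, ∀ k, ⟪p, v k⟫ ≤ c k := fun p hp => by rw [hP] at hp; exact hp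
  have hconv := convex_polygon hP
  have hfin := finite_extremePoints hv hP hcomp hint
  have hPtop : volume P ≠ ⊤ := hcomp.measure_lt_top.ne
  have : Fintype (P.extremePoints ℝ) := hfin.fintype
  choose C i j hi hj using fun w : P.extremePoints ℝ => exists_corner hv hP hcomp hint w.2
  let side : Fin m → Set (EuclideanSpace ℝ (Fin 2)) := fun k => {p ∈ P | ⟪p, v k⟫ = c k}
  let L : P.extremePoints ℝ → Set (EuclideanSpace ℝ (Fin 2)) :=
    fun w => {p ∈ P | (C w).snd p = 0}
  let R : P.extremePoints ℝ → Set (EuclideanSpace ℝ (Fin 2)) :=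
    fun w => {p ∈ P | (C w).fst p = 0}
  let S : Finset (Set (EuclideanSpace ℝ (Fin 2))) := Finset.univ.image side
  have hside : ∀ k, side k ∈ S := fun k => Finset.mem_image_of_mem _ (Finset.mem_univ k)
  have hLS : ∀ w, L w ∈ S := fun w => (show side (i w) = L w from hi w) ▸ hside (i w)
  have hRS : ∀ w, R w ∈ S := fun w => (show side (j w) = R w from hj w) ▸ hside (j w)
  have hLR : ∀ w, L w ≠ R w := by
    intro w h
    have h1 : (C w).left ∈ R w := h ▸ ⟨(C w).left_mem, (C w).snd_left⟩
    exact one_ne_zero ((C w).fst_left.symm.trans h1.2)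
  -- a point of `K` on each side
  have hpoint : ∀ F : Set (EuclideanSpace ℝ (Fin 2)), ∃ x, F ∈ S → x ∈ K ∧ x ∈ F := by
    intro F
    by_cases hF : F ∈ S
    · obtain ⟨k, -, rfl⟩ := Finset.mem_image.1 hF
      obtain ⟨x, hxK, hx⟩ := hK k
      exact ⟨x, fun _ => ⟨hxK, hKP hxK, hx⟩⟩
    · exact ⟨0, fun h => absurd h hF⟩
  choose x hx using hpoint
  let W : Finset (P.extremePoints ℝ) := Finset.univ.filter fun w =>
    (w : EuclideanSpace ℝ (Fin 2)) ∉ K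
  have hWK : ∀ w, w ∈ W ↔ (w : EuclideanSpace ℝ (Fin 2)) ∉ K := by simp [W]
  have hcap : ∀ w, volume (C w).cap ≠ ⊤ := fun w => measure_ne_top_of_subset (C w).cap_subset hPtop
  let G : (Set (EuclideanSpace ℝ (Fin 2)) → EuclideanSpace ℝ (Fin 2)) → ℝ := fun y =>
    ∑ w ∈ W, (volume (C w).cap).toReal * ((C w).fst (y (L w)) * (C w).snd (y (R w)))
  have hG : ∀ y F, ConvexOn ℝ Set.univ fun p => G (Function.update y F p) := by
    intro y F
    refine ⟨convex_univ, fun p _ q _ a b _ _ hab => le_of_eq ?_⟩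
    have haff : ∀ f : EuclideanSpace ℝ (Fin 2) →ᵃ[ℝ] ℝ, f (a • p + b • q) = a * f p + b * f q :=
      fun f => by simpa using Convex.combo_affine_apply (f := f) (x := p) (y := q) hab
    simp only [G, smul_eq_mul, Finset.mul_sum, ← Finset.sum_add_distrib]
    refine Finset.sum_congr rfl fun w _ => ?_
    by_cases h1 : L w = F
    · have h2 : R w ≠ F := fun h => hLR w (h1.trans h.symm)
      subst h1
      rw [Function.update_self, Function.update_of_ne h2, Function.update_self,
        Function.update_of_ne h2, Function.update_self, Function.update_of_ne h2, haff]
      ring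
    · by_cases h2 : R w = F
      · subst h2
        rw [Function.update_self, Function.update_of_ne h1, Function.update_self,
          Function.update_of_ne h1, Function.update_self, Function.update_of_ne h1, haff]
        ring
      · rw [Function.update_of_ne h1, Function.update_of_ne h1, Function.update_of_ne h1,
          Function.update_of_ne h2, Function.update_of_ne h2, Function.update_of_ne h2,
          ← add_mul, hab, one_mul]
  obtain ⟨y, hyS, -, hxy⟩ := exists_le_of_forall_mem_convexHull G hG
    (fun F => P.extremePoints ℝ ∩ F) S x (by
      intro F hF
      have hxF := (hx F hF).2
      obtain ⟨k, -, rfl⟩ := Finset.mem_image.1 hF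
      exact side_subset_convexHull hP hcomp hfin k hxF)
  have hVext : y '' S ⊆ P.extremePoints ℝ := by
    rintro _ ⟨F, hF, rfl⟩
    exact (hyS F hF).1
  refine ⟨y '' S, hVext, fun k => ⟨y (side k), ⟨_, hside k, rfl⟩, (hyS _ (hside k)).2.2⟩, ?_⟩
  let D : Finset (P.extremePoints ℝ) := W.filter fun w => y (L w) ≠ w ∧ y (R w) ≠ w
  have hD : ∀ w, w ∈ D ↔ w ∈ W ∧ y (L w) ≠ w ∧ y (R w) ≠ w := by simp [D]
  have hyL : ∀ w, y (L w) = w ∨ y (L w) = (C w).left := fun w =>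
    (C w).eq_or_eq_left hconv w.2.1 (hyS _ (hLS w)).1 (hyS _ (hLS w)).2.2
  have hyR : ∀ w, y (R w) = w ∨ y (R w) = (C w).right := fun w =>
    (C w).eq_or_eq_right hconv w.2.1 (hyS _ (hRS w)).1 (hyS _ (hRS w)).2.2
  have hDV : ∀ w ∈ D, (w : EuclideanSpace ℝ (Fin 2)) ∉ y '' S := by
    rintro w hw ⟨F, hF, hyF⟩
    obtain ⟨hwW, h1, h2⟩ := (hD w).1 hw
    have hwF : (w : EuclideanSpace ℝ (Fin 2)) ∈ F := hyF ▸ (hyS F hF).2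
    have hxF := hx F hF
    obtain ⟨k, -, rfl⟩ := Finset.mem_image.1 hF
    rcases (C w).side_eq (hv k) (fun p hp => hle p hp k) hwF.2 with h | h | h
    · exact (hWK w).1 hwW (h hxF.2 ▸ hxF.1)
    · exact h1 ((congrArg y h).symm.trans hyF)
    · exact h2 ((congrArg y h).symm.trans hyF)
  have hone : ∀ w ∈ D, ∀ z ∈ y '' (S : Set (Set (EuclideanSpace ℝ (Fin 2)))),
      1 ≤ (C w).fst z + (C w).snd z := fun w hw z hz =>
    (C w).one_le_of_extreme hconv w.2.1 (hVext hz) fun h => hDV w hw (h ▸ hz)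
  have hdisj : Set.PairwiseDisjoint (D : Set (P.extremePoints ℝ)) fun w => (C w).cap := by
    intro w hw z hz hwz
    obtain ⟨-, h1, h2⟩ := (hD w).1 hw
    refine (C w).disjoint_cap_cap (C z) ?_ ?_ ?_
    · exact (C z).one_le_of_extreme hconv z.2.1 w.2 fun h => hwz (Subtype.ext h)
    · exact hone z hz _ ⟨L w, hLS w, (hyL w).resolve_left h1⟩
    · exact hone z hz _ ⟨R w, hRS w, (hyR w).resolve_left h2⟩
  have hGy : G y ≤ ∑ w ∈ D, (volume (C w).cap).toReal := by
    simp only [G, D, Finset.sum_filter]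
    refine Finset.sum_le_sum fun w _ => ?_
    rcases hyL w with h1 | h1
    · rw [h1, (C w).fst_self]
      simp
    rcases hyR w with h2 | h2
    · rw [h2, (C w).snd_self]
      simp
    have h3 : (C w).left ≠ w := fun h =>
      one_ne_zero ((C w).fst_left.symm.trans ((congrArg _ h).trans (C w).fst_self))
    have h4 : (C w).right ≠ w := fun h =>
      one_ne_zero ((C w).snd_right.symm.trans ((congrArg _ h).trans (C w).snd_self))
    rw [h1, h2, if_pos ⟨h3, h4⟩, (C w).fst_left, (C w).snd_right]
    simp
  have hVP : volume (convexHull ℝ (y '' S)) + ENNReal.ofReal (G y) ≤ volume P := by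
    calc volume (convexHull ℝ (y '' S)) + ENNReal.ofReal (G y)
        ≤ volume (convexHull ℝ (y '' S)) + ∑ w ∈ D, volume (C w).cap := by
          gcongr
          refine (ENNReal.ofReal_le_ofReal hGy).trans ?_
          rw [← ENNReal.toReal_sum fun w _ => hcap w]
          exact ENNReal.ofReal_toReal_le
      _ = volume (convexHull ℝ (y '' S) ∪ ⋃ w ∈ D, (C w).cap) := by
          rw [measure_union _ (D.measurableSet_biUnion fun w _ =>
            (C w).measurableSet_cap hcomp.isClosed), measure_biUnion_finset hdisj fun w _ =>
            (C w).measurableSet_cap hcomp.isClosed]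
          rw [Set.disjoint_iUnion₂_right]
          exact fun w hw => (C w).disjoint_convexHull_cap (hone w hw)
      _ ≤ volume P := by
          refine measure_mono (Set.union_subset ?_ (Set.iUnion₂_subset fun w _ => (C w).cap_subset))
          exact convexHull_min (hVext.trans extremePoints_subset) hconv
  have hx0 : ∀ w ∈ W, 0 < (C w).fst (x (L w)) ∧ 0 < (C w).snd (x (R w)) := by
    intro w hw
    obtain ⟨h1, h2, h3⟩ := hx _ (hLS w)
    obtain ⟨h4, h5, h6⟩ := hx _ (hRS w)
    have hwK := (hWK w).1 hw
    constructor
    · refine ((C w).fst_nonneg _ h2).lt_of_ne fun h => hwK ?_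
      rwa [← (C w).ext (h.symm.trans (C w).fst_self.symm) (h3.trans (C w).snd_self.symm)]
    · refine ((C w).snd_nonneg _ h5).lt_of_ne fun h => hwK ?_
      rwa [← (C w).ext (h6.trans (C w).fst_self.symm) (h.symm.trans (C w).snd_self.symm)]
  let T : P.extremePoints ℝ → Set (EuclideanSpace ℝ (Fin 2)) := fun w =>
    {p | 0 ≤ (C w).fst p ∧ 0 ≤ (C w).snd p ∧
      (C w).fst p / (C w).fst (x (L w)) + (C w).snd p / (C w).snd (x (R w)) < 1}
  have hcover : P ⊆ K ∪ ⋃ w ∈ W, T w := by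
    intro p hp
    by_cases hpK : p ∈ K
    · exact Or.inl hpK
    right
    obtain ⟨l, d, hlK, hlp⟩ := geometric_hahn_banach_closed_point hKconv hKc hpK
    obtain ⟨w, hw, hlw⟩ := exists_extremePoint_of_notMem hcomp hconv hp hlp
    have hwW : (⟨w, hw⟩ : P.extremePoints ℝ) ∈ W :=
      (hWK _).2 fun h => absurd (hlK w h) (not_lt.2 hlw.le)
    obtain ⟨h1, h2⟩ := hx0 _ hwW
    refine Set.mem_iUnion₂.2 ⟨⟨w, hw⟩, hwW, (C _).fst_nonneg p hp, (C _).snd_nonneg p hp, ?_⟩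
    exact (C _).div_add_div_lt_one l.toLinearMap hp (hx _ (hLS _)).2.2 (hx _ (hRS _)).2.2 h1 h2
      (hlK _ (hx _ (hLS _)).1) (hlK _ (hx _ (hRS _)).1) hlp hlw
  have hPK : volume P ≤ volume K + ENNReal.ofReal (G x) := by
    calc volume P ≤ volume K + ∑ w ∈ W, volume (T w) :=
          (measure_mono hcover).trans ((measure_union_le _ _).trans
            (add_le_add_right (measure_biUnion_finset_le _ _) _))
      _ ≤ volume K + ENNReal.ofReal (G x) := by
          gcongr
          rw [ENNReal.ofReal_sum_of_nonneg fun w hw =>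
            mul_nonneg ENNReal.toReal_nonneg (mul_pos (hx0 w hw).1 (hx0 w hw).2).le]
          refine Finset.sum_le_sum fun w hw => ?_
          rw [ENNReal.ofReal_mul ENNReal.toReal_nonneg, ENNReal.ofReal_toReal (hcap w), mul_comm]
          exact (C w).volume_triangle_le hconv w.2.1 (hx0 w hw).1 (hx0 w hw).2
  have hfinal := hVP.trans (hPK.trans (add_le_add_right (ENNReal.ofReal_le_ofReal hxy) _))
  exact (ENNReal.add_le_add_iff_right ENNReal.ofReal_ne_top).1 hfinal

end Polygon

/-- Among closed convex sets inscribed in a convex polygon `P` (contained in `P` and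
touching every side), a minimizer of area exists which is the convex hull of a subset
of the vertices (extreme points) of `P`. -/
theorem min_area_inscribed_in_polygon
    (m : ℕ) (v : Fin m → EuclideanSpace ℝ (Fin 2)) (c : Fin m → ℝ)
    (hv : ∀ i, v i ≠ 0)
    (P : Set (EuclideanSpace ℝ (Fin 2)))
    (hP : P = {x | ∀ i : Fin m, ⟪x, v i⟫ ≤ c i})
    (hcomp : IsCompact P) (hint : (interior P).Nonempty)
    (hside : ∀ i : Fin m, ∃ x ∈ P, ⟪x, v i⟫ = c i) :
    ∃ V : Set (EuclideanSpace ℝ (Fin 2)), V ⊆ Set.extremePoints ℝ P ∧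
      convexHull ℝ V ⊆ P ∧
      (∀ i : Fin m, ∃ x ∈ convexHull ℝ V, ⟪x, v i⟫ = c i) ∧
      ∀ K : Set (EuclideanSpace ℝ (Fin 2)), IsClosed K → Convex ℝ K → K ⊆ P →
        (∀ i : Fin m, ∃ x ∈ K, ⟪x, v i⟫ = c i) →
        volume (convexHull ℝ V) ≤ volume K := by
  have hconv := convex_polygon hP
  have hfin := finite_extremePoints hv hP hcomp hint
  obtain ⟨V, ⟨hVext, hVside⟩, hmin⟩ := Set.exists_min_image
    {V : Set (EuclideanSpace ℝ (Fin 2)) | V ⊆ P.extremePoints ℝ ∧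
      ∀ i : Fin m, ∃ x ∈ V, ⟪x, v i⟫ = c i} (fun V => volume (convexHull ℝ V))
    (hfin.finite_subsets.subset fun V hV => hV.1) (by
      obtain ⟨V, h1, h2, -⟩ := exists_vertices_volume_le hv hP hcomp hint hcomp.isClosed hconv
        subset_rfl hside
      exact ⟨V, h1, h2⟩)
  refine ⟨V, hVext, convexHull_min (hVext.trans extremePoints_subset) hconv, fun i => ?_, ?_⟩
  · obtain ⟨x, hx, h⟩ := hVside i
    exact ⟨x, subset_convexHull ℝ V hx, h⟩
  · intro K hKc hKconv hKP hK
    obtain ⟨V', h1, h2, h3⟩ := exists_vertices_volume_le hv hP hcomp hint hKc hKconv hKP hK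
    exact (hmin V' ⟨h1, h2⟩).trans h3
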